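/- arXiv:2209.10522 — 2 statements merged into one kernel-verified Lean document; each statement's English description precedes it below -/
import Mathlib

section
/- For every real y > 0, the fourth power of θ₂ satisfies (Σ_{n∈ℤ} e^{−π(n+1/2)² y})⁴ = 16 Σ_{n=1}^∞ b(n) e^{−π n y}, where the series on the right converges absolutely. -/
open scoped Real
open Real

noncomputable section

/-- `b(n) = σ₁(n)` for odd `n`, `b(n) = 0` for even `n`. -/
def paperB (n : ℕ) : ℤ :=
  if Odd n then (ArithmeticFunction.sigma 1 n : ℤ) else 0

/-- The triples `(m, d, e)` of integers with `d, e > 0` and `m ^ 2 + 4 * d * e = M`. -/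
def windmill (M : ℤ) : Finset (ℤ × ℤ × ℤ) :=
  (Finset.Icc (-M) M ×ˢ Finset.Icc 1 M ×ˢ Finset.Icc 1 M).filter
    fun s => s.1 ^ 2 + 4 * s.2.1 * s.2.2 = M

theorem mem_windmill {M m d e : ℤ} :
    (m, d, e) ∈ windmill M ↔ m ^ 2 + 4 * d * e = M ∧ 0 < d ∧ 0 < e := by
  simp only [windmill, Finset.mem_filter, Finset.mem_product, Finset.mem_Icc]
  constructor
  · rintro ⟨⟨-, ⟨hd, -⟩, he, -⟩, h⟩
    exact ⟨h, by lia, by lia⟩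
  · rintro ⟨h, hd, he⟩
    refine ⟨⟨⟨?_, ?_⟩, ⟨by lia, ?_⟩, by lia, ?_⟩, h⟩ <;>
      nlinarith [mul_pos hd he, sq_nonneg (m - 1), sq_nonneg (m + 1), sq_nonneg m]

theorem sum_windmill_of_odd (M : ℤ) (f : ℤ → ℤ → ℤ → ℤ) (hf : ∀ m d e, f (-m) d e = -f m d e) :
    ∑ s ∈ windmill M, f s.1 s.2.1 s.2.2 = 0 := by
  have h : ∑ s ∈ windmill M, f s.1 s.2.1 s.2.2 = ∑ s ∈ windmill M, -f s.1 s.2.1 s.2.2 := by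
    refine Finset.sum_nbij' (fun s => (-s.1, s.2)) (fun s => (-s.1, s.2)) ?_ ?_ ?_ ?_ ?_
    · rintro ⟨m, d, e⟩ hs
      simpa [mem_windmill] using hs
    · rintro ⟨m, d, e⟩ hs
      simpa [mem_windmill] using hs
    · simp
    · simp
    · simp [hf]
  rw [Finset.sum_neg_distrib] at h
  lia

/-- Contributions of a function changing sign under Zagier's involution
`(m, d, e) ↦ (-m - 2 * e, d - m - e, e)` cancel. -/
theorem sum_windmill_filter_eq_zero (M : ℤ) (f : ℤ → ℤ → ℤ → ℤ)
    (hf : ∀ m d e, f (-m - 2 * e) (d - m - e) e = -f m d e) :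
    ∑ s ∈ windmill M with s.1 < s.2.1 - s.2.2, f s.1 s.2.1 s.2.2 = 0 := by
  have h : ∑ s ∈ windmill M with s.1 < s.2.1 - s.2.2, f s.1 s.2.1 s.2.2 =
      ∑ s ∈ windmill M with s.1 < s.2.1 - s.2.2, -f s.1 s.2.1 s.2.2 := by
    have key : ∀ s ∈ {s ∈ windmill M | s.1 < s.2.1 - s.2.2},
        (-s.1 - 2 * s.2.2, s.2.1 - s.1 - s.2.2, s.2.2) ∈
          {s ∈ windmill M | s.1 < s.2.1 - s.2.2} := by
      rintro ⟨m, d, e⟩ hs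
      simp only [Finset.mem_filter, mem_windmill] at hs ⊢
      obtain ⟨⟨h, hd, he⟩, hlt⟩ := hs
      exact ⟨⟨by linarith, by lia, he⟩, by lia⟩
    refine Finset.sum_nbij' (fun s => (-s.1 - 2 * s.2.2, s.2.1 - s.1 - s.2.2, s.2.2))
      (fun s => (-s.1 - 2 * s.2.2, s.2.1 - s.1 - s.2.2, s.2.2)) key key ?_ ?_ ?_
    · rintro ⟨m, d, e⟩ -
      ext <;> grind
    · rintro ⟨m, d, e⟩ -
      ext <;> grind
    · rintro ⟨m, d, e⟩ -
      simp [hf]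
  rw [Finset.sum_neg_distrib] at h
  lia

theorem sum_windmill_eq_zero (n : ℤ) :
    ∑ s ∈ windmill (8 * n + 5), (s.2.1 * s.2.2 - s.1 ^ 2) * s.2.1 = 0 := by
  have hodd := sum_windmill_of_odd (8 * n + 5) (fun m d _ => m * d ^ 2) (by intros; ring)
  have hswap : ∑ s ∈ windmill (8 * n + 5) with ¬ s.1 < s.2.1 - s.2.2,
        ((s.2.1 * s.2.2 - s.1 ^ 2) * s.2.1 + s.1 * s.2.1 ^ 2) =
      ∑ s ∈ windmill (8 * n + 5) with s.1 < s.2.1 - s.2.2,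
        ((s.2.1 * s.2.2 - s.1 ^ 2) * s.2.2 - s.1 * s.2.2 ^ 2) := by
    refine Finset.sum_nbij' (fun s => (-s.1, s.2.2, s.2.1)) (fun s => (-s.1, s.2.2, s.2.1))
      ?_ ?_ ?_ ?_ ?_
    · rintro ⟨m, d, e⟩ hs
      simp only [Finset.mem_filter, mem_windmill] at hs ⊢
      obtain ⟨⟨h, hd, he⟩, hle⟩ := hs
      refine ⟨⟨by linarith, he, hd⟩, ?_⟩
      have hne : m ≠ d - e := by
        intro hm
        have hsq : (d + e) ^ 2 = 8 * n + 5 := by rw [← h, hm]; ring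
        have hmod := congrArg (fun x : ℤ => (x : ZMod 8)) hsq
        push_cast at hmod
        have h8 : (8 : ZMod 8) = 0 := rfl
        rw [h8, zero_mul, zero_add] at hmod
        generalize (d + e : ZMod 8) = x at hmod
        revert x
        decide
      lia
    · rintro ⟨m, d, e⟩ hs
      simp only [Finset.mem_filter, mem_windmill] at hs ⊢
      obtain ⟨⟨h, hd, he⟩, hlt⟩ := hs
      exact ⟨⟨by linarith, he, hd⟩, by lia⟩
    · simp
    · simp
    · intro s _
      ring
  have hzero := sum_windmill_filter_eq_zero (8 * n + 5)
    (fun m d e => (d * e - m ^ 2) * (d + e) + m * (d ^ 2 - e ^ 2)) (by intros; ring)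
  have hsplit := Finset.sum_filter_add_sum_filter_not (windmill (8 * n + 5))
    (fun s => s.1 < s.2.1 - s.2.2)
    (fun s => (s.2.1 * s.2.2 - s.1 ^ 2) * s.2.1 + s.1 * s.2.1 ^ 2)
  rw [hswap, ← Finset.sum_add_distrib, Finset.sum_add_distrib (s := windmill (8 * n + 5)), hodd,
    add_zero] at hsplit
  rw [← hsplit, ← hzero]
  exact Finset.sum_congr rfl fun s _ => by ring

def triangular (t : ℕ) : ℕ := t * (t + 1) / 2

theorem two_mul_triangular (t : ℕ) : 2 * triangular t = t * (t + 1) :=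
  Nat.two_mul_div_two_of_even (Nat.even_mul_succ_self t)

theorem triangular_injective : Function.Injective triangular := by
  refine StrictMono.injective (strictMono_nat_of_lt_succ fun t => ?_)
  have h₁ := two_mul_triangular t
  have h₂ := two_mul_triangular (t + 1)
  nlinarith

open Classical in
/-- The indicator function of the triangular numbers. -/
def triangularIndicator (k : ℕ) : ℝ := if k ∈ Set.range triangular then 1 else 0

/-- The integers whose square is `8 * i + 1`. -/
def squareRoots (i : ℕ) : Finset ℤ :=
  (Finset.Icc (-(8 * i + 1) : ℤ) (8 * i + 1)).filter fun m => m ^ 2 = 8 * i + 1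

theorem mem_squareRoots {i : ℕ} {m : ℤ} : m ∈ squareRoots i ↔ m ^ 2 = 8 * i + 1 := by
  simp only [squareRoots, Finset.mem_filter, Finset.mem_Icc, and_iff_right_iff_imp]
  intro h
  constructor <;> nlinarith [sq_nonneg (m - 1), sq_nonneg (m + 1)]

theorem card_squareRoots (i : ℕ) : ((squareRoots i).card : ℝ) = 2 * triangularIndicator i := by
  unfold triangularIndicator
  split_ifs with h
  · obtain ⟨t, rfl⟩ := h
    have ht : (2 * triangular t : ℤ) = t * (t + 1) := mod_cast two_mul_triangular t
    have : squareRoots (triangular t) = {2 * (t : ℤ) + 1, -(2 * (t : ℤ) + 1)} := by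
      ext m
      rw [mem_squareRoots, show (8 * triangular t + 1 : ℤ) = (2 * t + 1) ^ 2 by linarith,
        sq_eq_sq_iff_eq_or_eq_neg]
      simp
    rw [this, Finset.card_pair (by lia)]
    norm_num
  · rw [Finset.card_eq_zero.mpr]
    · simp
    refine Finset.eq_empty_of_forall_notMem fun m hm => h ?_
    rw [mem_squareRoots] at hm
    have hodd : Odd m := by
      have : Odd (m ^ 2) := ⟨4 * i, by rw [hm]; ring⟩
      exact (Int.odd_pow' two_ne_zero).mp this
    obtain ⟨k, hk⟩ := Int.natAbs_odd.mpr hodd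
    refine ⟨k, ?_⟩
    have hk' := two_mul_triangular k
    have h1 : (m.natAbs : ℤ) ^ 2 = 8 * i + 1 := by rw [Int.natAbs_sq, hm]
    have h2 : m.natAbs ^ 2 = 8 * i + 1 := by exact_mod_cast h1
    rw [hk] at h2
    nlinarith

theorem exists_of_mem_windmill {n : ℕ} {m d e : ℤ} (h : (m, d, e) ∈ windmill (8 * n + 5)) :
    ∃ i j : ℕ, m ^ 2 = 8 * i + 1 ∧ d * e = 2 * j + 1 ∧ i + j = n := by
  obtain ⟨h, hd, he⟩ := mem_windmill.mp h
  have hde := mul_pos hd he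
  have hodd : Odd m := by
    have : Odd (m ^ 2) := ⟨4 * n + 2 - 2 * (d * e), by linarith⟩
    exact (Int.odd_pow' two_ne_zero).mp this
  obtain ⟨k, rfl⟩ := hodd
  obtain ⟨i, hi⟩ := Int.even_mul_succ_self k
  have hi0 : 0 ≤ i := by nlinarith [sq_nonneg (2 * k + 1)]
  lift i to ℕ using hi0
  refine ⟨i, n - i, by linarith, ?_, ?_⟩
  · rw [Nat.cast_sub (by nlinarith)]
    linarith
  · have : i ≤ n := by nlinarith
    lia

theorem sum_windmill_fiber (n i j : ℕ) (hij : i + j = n) :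
    ∑ s ∈ windmill (8 * n + 5) with s.1 ^ 2 = 8 * (i : ℤ) + 1, s.2.1 =
      (squareRoots i).card * (ArithmeticFunction.sigma 1 (2 * j + 1) : ℤ) := by
  have hprod : ∑ s ∈ squareRoots i ×ˢ (2 * j + 1).divisorsAntidiagonal, (s.2.1 : ℤ) =
      (squareRoots i).card * (ArithmeticFunction.sigma 1 (2 * j + 1) : ℤ) := by
    rw [Finset.sum_product]
    dsimp only
    rw [Finset.sum_const, nsmul_eq_mul, ArithmeticFunction.sigma_one_apply,
      Nat.sum_divisorsAntidiagonal (fun d _ => (d : ℤ)), Nat.cast_sum]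
  rw [← hprod]
  subst hij
  refine Finset.sum_nbij' (fun s => (s.1, s.2.1.toNat, s.2.2.toNat))
    (fun s => (s.1, (s.2.1 : ℤ), (s.2.2 : ℤ))) ?_ ?_ ?_ ?_ ?_
  · rintro ⟨m, d, e⟩ hs
    simp only [Finset.mem_filter, mem_windmill] at hs
    obtain ⟨⟨h, hd, he⟩, hm⟩ := hs
    lift d to ℕ using hd.le
    lift e to ℕ using he.le
    simp only [Finset.mem_product, mem_squareRoots, Nat.mem_divisorsAntidiagonal, Int.toNat_natCast]
    refine ⟨hm, ?_, by lia⟩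
    zify
    push_cast at h
    linarith
  · rintro ⟨m, d, e⟩ hs
    simp only [Finset.mem_product, mem_squareRoots, Nat.mem_divisorsAntidiagonal] at hs
    obtain ⟨hm, hde, -⟩ := hs
    simp only [Finset.mem_filter, mem_windmill]
    have hpos : 0 < d * e := by lia
    have hde' : (d * e : ℤ) = 2 * j + 1 := mod_cast hde
    refine ⟨⟨?_, mod_cast Nat.pos_of_mul_pos_right hpos, mod_cast Nat.pos_of_mul_pos_left hpos⟩, hm⟩
    push_cast
    linarith
  · rintro ⟨m, d, e⟩ hs
    simp only [Finset.mem_filter, mem_windmill] at hs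
    obtain ⟨⟨-, hd, he⟩, -⟩ := hs
    simp [hd.le, he.le]
  · simp
  · rintro ⟨m, d, e⟩ hs
    simp only [Finset.mem_filter, mem_windmill] at hs
    obtain ⟨⟨-, hd, -⟩, -⟩ := hs
    simp [hd.le]

theorem sum_antidiagonal_triangularIndicator_mul_sigma (n : ℕ) :
    ∑ p ∈ Finset.HasAntidiagonal.antidiagonal n, ((p.2 : ℝ) - 4 * p.1) *
      (triangularIndicator p.1 * (ArithmeticFunction.sigma 1 (2 * p.2 + 1) : ℝ)) = 0 := by
  have hfiber := Finset.sum_fiberwise_of_maps_to (s := windmill (8 * n + 5))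
    (t := Finset.HasAntidiagonal.antidiagonal n)
    (g := fun s => (((s.1 ^ 2 - 1) / 8).toNat, n - ((s.1 ^ 2 - 1) / 8).toNat)) (by
      rintro ⟨m, d, e⟩ hs
      obtain ⟨i, j, hi, -, hij⟩ := exists_of_mem_windmill hs
      simp only [Finset.HasAntidiagonal.mem_antidiagonal]
      lia)
    (fun s => (s.2.1 * s.2.2 - s.1 ^ 2) * s.2.1)
  rw [sum_windmill_eq_zero] at hfiber
  have hint : ∑ p ∈ Finset.HasAntidiagonal.antidiagonal n, ((p.2 : ℤ) - 4 * p.1) *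
      ((squareRoots p.1).card * (ArithmeticFunction.sigma 1 (2 * p.2 + 1) : ℤ)) = 0 := by
    suffices h : 2 * ∑ p ∈ Finset.HasAntidiagonal.antidiagonal n, ((p.2 : ℤ) - 4 * p.1) *
        ((squareRoots p.1).card * (ArithmeticFunction.sigma 1 (2 * p.2 + 1) : ℤ)) = 0 by lia
    rw [← hfiber, Finset.mul_sum]
    refine Finset.sum_congr rfl ?_
    rintro ⟨i, j⟩ hp
    rw [Finset.HasAntidiagonal.mem_antidiagonal] at hp
    dsimp only at hp ⊢
    rw [← sum_windmill_fiber n i j hp, ← mul_assoc, Finset.mul_sum]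
    have hfilter : {s ∈ windmill (8 * n + 5) | s.1 ^ 2 = 8 * (i : ℤ) + 1} =
        {s ∈ windmill (8 * n + 5) |
          (((s.1 ^ 2 - 1) / 8).toNat, n - ((s.1 ^ 2 - 1) / 8).toNat) = (i, j)} := by
      refine Finset.filter_congr ?_
      rintro ⟨m, d, e⟩ hs
      obtain ⟨i', j', hi, -, hij⟩ := exists_of_mem_windmill hs
      simp only [Prod.mk.injEq]
      lia
    rw [← hfilter]
    refine Finset.sum_congr rfl ?_
    rintro ⟨m, d, e⟩ hs
    rw [Finset.mem_filter] at hs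
    obtain ⟨i', j', hi, hde, hij⟩ := exists_of_mem_windmill hs.1
    have hm := hs.2
    dsimp only at hm ⊢
    obtain rfl : i' = i := by lia
    obtain rfl : j' = j := by lia
    rw [hde, hm]
    ring
  have hreal := congrArg (fun x : ℤ => (x : ℝ)) hint
  push_cast at hreal
  simp only [card_squareRoots] at hreal
  suffices h : 2 * ∑ p ∈ Finset.HasAntidiagonal.antidiagonal n, ((p.2 : ℝ) - 4 * p.1) *
      (triangularIndicator p.1 * (ArithmeticFunction.sigma 1 (2 * p.2 + 1) : ℝ)) = 0 by linarith
  rw [← hreal, Finset.mul_sum]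
  exact Finset.sum_congr rfl fun _ _ => by ring

open PowerSeries in
theorem mk_triangularIndicator_pow_four :
    (mk triangularIndicator) ^ 4 =
      mk fun k => (ArithmeticFunction.sigma 1 (2 * k + 1) : ℝ) := by
  set A : ℝ⟦X⟧ := mk triangularIndicator with hA
  set B : ℝ⟦X⟧ := mk fun k => (ArithmeticFunction.sigma 1 (2 * k + 1) : ℝ) with hB
  have hcoeff (f : ℝ⟦X⟧) (k : ℕ) : coeff k (X * d⁄dX ℝ f) = k * coeff k f := by
    cases k with
    | zero => simp
    | succ k =>
      rw [coeff_succ_X_mul, coeff_derivative]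
      push_cast
      ring
  have hA0 : constantCoeff A = 1 := by
    rw [hA, ← coeff_zero_eq_constantCoeff_apply, coeff_mk, triangularIndicator,
      if_pos ⟨0, by simp [triangular]⟩]
  have hB0 : constantCoeff B = 1 := by
    rw [hB, ← coeff_zero_eq_constantCoeff_apply, coeff_mk]
    simp
  have hode : A * d⁄dX ℝ B = 4 * d⁄dX ℝ A * B := by
    refine mul_left_cancel₀ (X_ne_zero (R := ℝ)) ?_
    rw [show X * (A * d⁄dX ℝ B) = A * (X * d⁄dX ℝ B) by ring,
      show X * (4 * d⁄dX ℝ A * B) = C 4 * ((X * d⁄dX ℝ A) * B) by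
        rw [show (C 4 : ℝ⟦X⟧) = 4 from map_ofNat C 4]; ring]
    ext n
    rw [coeff_C_mul, coeff_mul, coeff_mul, Finset.mul_sum, ← sub_eq_zero,
      ← Finset.sum_sub_distrib, ← sum_antidiagonal_triangularIndicator_mul_sigma n]
    refine Finset.sum_congr rfl fun p _ => ?_
    rw [hcoeff, hcoeff, hA, hB, coeff_mk, coeff_mk]
    ring
  have hunit : A * A⁻¹ = 1 := PowerSeries.mul_inv_cancel A (by simp [hA0])
  have hquot : B * A⁻¹ ^ 4 = 1 := by
    refine derivative.ext ?_ (by simp [hA0, hB0])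
    have hBd : d⁄dX ℝ B = 4 * d⁄dX ℝ A * B * A⁻¹ := by
      rw [← hode, mul_right_comm, hunit, one_mul]
    rw [Derivation.leibniz, derivative_pow, derivative_inv', hBd, Derivation.map_one_eq_zero]
    simp only [smul_eq_mul]
    push_cast
    ring
  calc A ^ 4 = B * A⁻¹ ^ 4 * A ^ 4 := by rw [hquot, one_mul]
    _ = B * (A * A⁻¹) ^ 4 := by ring
    _ = B := by rw [hunit, one_pow, mul_one]

theorem summable_triangularIndicator {r : ℝ} (h₀ : 0 ≤ r) (h₁ : r < 1) :
    Summable fun k => triangularIndicator k * r ^ k := by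
  refine (summable_geometric_of_lt_one h₀ h₁).of_nonneg_of_le (fun k => ?_) fun k => ?_ <;>
  · unfold triangularIndicator
    split_ifs <;> simp [pow_nonneg h₀ k]

theorem tsum_triangularIndicator (r : ℝ) :
    ∑' k, triangularIndicator k * r ^ k = ∑' t, r ^ triangular t := by
  rw [← triangular_injective.tsum_eq]
  · exact tsum_congr fun t => by simp [triangularIndicator]
  · intro k hk
    by_contra h
    exact hk (by simp [triangularIndicator, h])

theorem summable_norm_coeff_mul_and_tsum {f g : PowerSeries ℝ} {r : ℝ}
    (hf : Summable fun k => ‖f.coeff k * r ^ k‖) (hg : Summable fun k => ‖g.coeff k * r ^ k‖) :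
    (Summable fun k => ‖(f * g).coeff k * r ^ k‖) ∧
      ∑' k, (f * g).coeff k * r ^ k = (∑' k, f.coeff k * r ^ k) * ∑' k, g.coeff k * r ^ k := by
  have h (k : ℕ) : ∑ p ∈ Finset.HasAntidiagonal.antidiagonal k,
      f.coeff p.1 * r ^ p.1 * (g.coeff p.2 * r ^ p.2) = (f * g).coeff k * r ^ k := by
    rw [PowerSeries.coeff_mul, Finset.sum_mul]
    refine Finset.sum_congr rfl fun p hp => ?_
    rw [← Finset.HasAntidiagonal.mem_antidiagonal.mp hp, pow_add]
    ring
  have hs := summable_norm_sum_mul_antidiagonal_of_summable_norm hf hg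
  have ht := tsum_mul_tsum_eq_tsum_sum_antidiagonal_of_summable_norm hf hg
  simp only [h] at hs ht
  exact ⟨hs, ht.symm⟩

theorem summable_norm_sigma_and_tsum {r : ℝ} (h₀ : 0 ≤ r) (h₁ : r < 1) :
    (Summable fun k => ‖(ArithmeticFunction.sigma 1 (2 * k + 1) : ℝ) * r ^ k‖) ∧
      ∑' k, (ArithmeticFunction.sigma 1 (2 * k + 1) : ℝ) * r ^ k =
        (∑' t, r ^ triangular t) ^ 4 := by
  have hA : Summable fun k => ‖(PowerSeries.mk triangularIndicator).coeff k * r ^ k‖ := by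
    simpa only [PowerSeries.coeff_mk] using (summable_triangularIndicator h₀ h₁).norm
  obtain ⟨hs₂, ht₂⟩ := summable_norm_coeff_mul_and_tsum hA hA
  obtain ⟨hs₄, ht₄⟩ := summable_norm_coeff_mul_and_tsum hs₂ hs₂
  rw [ht₂] at ht₄
  have hpow (f : PowerSeries ℝ) : f * f * (f * f) = f ^ 4 := by ring
  rw [hpow, mk_triangularIndicator_pow_four] at hs₄ ht₄
  simp only [PowerSeries.coeff_mk, tsum_triangularIndicator] at hs₄ ht₄
  exact ⟨hs₄, by rw [ht₄]; ring⟩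

theorem theta2_eq (y : ℝ) (hy : 0 < y) :
    ∑' n : ℤ, Real.exp (-(π * ((n : ℝ) + 1 / 2) ^ 2 * y)) =
      2 * Real.exp (-(π * y / 4)) * ∑' t, Real.exp (-(2 * π * y)) ^ triangular t := by
  have hterm (t : ℕ) : Real.exp (-(π * ((t : ℝ) + 1 / 2) ^ 2 * y)) =
      Real.exp (-(π * y / 4)) * Real.exp (-(2 * π * y)) ^ triangular t := by
    rw [← Real.exp_nat_mul, ← Real.exp_add]
    have ht : (2 * triangular t : ℝ) = t * (t + 1) := mod_cast two_mul_triangular t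
    congr 1
    linear_combination (π * y) * ht
  have hneg (t : ℕ) : Real.exp (-(π * (((-(t + 1) : ℤ) : ℝ) + 1 / 2) ^ 2 * y)) =
      Real.exp (-(π * ((t : ℝ) + 1 / 2) ^ 2 * y)) := by
    congr 1
    push_cast
    ring
  have hsum : Summable fun t : ℕ => Real.exp (-(π * ((t : ℝ) + 1 / 2) ^ 2 * y)) := by
    simp only [hterm]
    refine Summable.mul_left _ ?_
    refine (summable_geometric_of_lt_one (Real.exp_nonneg _) ?_).comp_injective
      triangular_injective
    rw [Real.exp_lt_one_iff, neg_lt_zero]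
    positivity
  rw [tsum_of_nat_of_neg_add_one (by simpa using hsum) (by simpa only [hneg] using hsum)]
  simp only [hneg, Int.cast_natCast, hterm, tsum_mul_left]
  ring

theorem theta2_pow_four (y : ℝ) (hy : 0 < y) :
    Summable (fun n : ℕ => |(paperB n : ℝ) * Real.exp (-(π * n * y))|) ∧
    (∑' n : ℤ, Real.exp (-(π * ((n : ℝ) + 1 / 2) ^ 2 * y))) ^ 4 =
      16 * ∑' n : ℕ, (paperB n : ℝ) * Real.exp (-(π * n * y)) := by
  have hr : Real.exp (-(2 * π * y)) < 1 := by
    rw [Real.exp_lt_one_iff, neg_lt_zero]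
    positivity
  obtain ⟨hs, ht⟩ := summable_norm_sigma_and_tsum (Real.exp_nonneg _) hr
  have hinj : Function.Injective fun k : ℕ => 2 * k + 1 := fun a b h => by
    simpa using h
  have hzero (n : ℕ) (hn : n ∉ Set.range fun k : ℕ => 2 * k + 1) : paperB n = 0 :=
    if_neg fun ⟨k, hk⟩ => hn ⟨k, hk.symm⟩
  have hterm (k : ℕ) : (paperB (2 * k + 1) : ℝ) * Real.exp (-(π * (2 * k + 1 : ℕ) * y)) =
      Real.exp (-(π * y)) *
        ((ArithmeticFunction.sigma 1 (2 * k + 1) : ℝ) * Real.exp (-(2 * π * y)) ^ k) := by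
    rw [paperB, if_pos (odd_two_mul_add_one k), ← Real.exp_nat_mul, mul_left_comm, ← Real.exp_add]
    push_cast
    congr 2
    ring
  constructor
  · rw [← hinj.summable_iff (fun n hn => by simp [hzero n hn])]
    simp only [Function.comp_def, hterm, abs_mul (Real.exp _)]
    exact hs.mul_left _
  · rw [theta2_eq y hy,
      ← hinj.tsum_eq (f := fun n : ℕ => (paperB n : ℝ) * Real.exp (-(π * n * y)))]
    · simp only [hterm, tsum_mul_left, ht]
      rw [mul_pow, mul_pow, ← Real.exp_nat_mul]
      rw [show ((4 : ℕ) : ℝ) * -(π * y / 4) = -(π * y) by push_cast; ring]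
      ring
    · intro n hn
      by_contra h
      exact hn (by simp [hzero n h])
end
end

section
/- For every real y > 0, the fourth power of θ₄ satisfies (Σ_{n∈ℤ} (−1)^n e^{−π n² y})⁴ = 1 − 8 Σ_{k=1}^∞ c(k) e^{−π k y}, where the series on the right converges absolutely. -/
open scoped Real
open Real

noncomputable section

/-- `c(n) = σ₁(n)` for odd `n`, `c(2^l m) = −3 σ₁(m)` for `l ≥ 1` and `m` odd. -/
def paperC (n : ℕ) : ℤ :=
  if Odd n then (ArithmeticFunction.sigma 1 n : ℤ)
  else -3 * (ArithmeticFunction.sigma 1 (ordCompl[2] n) : ℤ)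

/-- The weight-two Eisenstein series `E₂`, extended to a function on `ℂ`. -/
def eisensteinTwo (τ : ℂ) : ℂ := EisensteinSeries.E2 (UpperHalfPlane.ofComplex τ)

lemma hasSum_eisensteinTwo {τ : ℂ} (hτ : 0 < τ.im) :
    HasSum (fun m : ℕ => (if m = 0 then 1 else -24 * (ArithmeticFunction.sigma 1 m : ℂ)) *
      Complex.exp (2 * π * Complex.I * τ) ^ m) (eisensteinTwo τ) := by
  have h := EisensteinSeries.hasSum_qExpansion_E2 (z := ⟨τ, hτ⟩)
  rw [eisensteinTwo, UpperHalfPlane.ofComplex_apply_of_im_pos hτ]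
  simpa using h

lemma eisensteinTwo_add_one {τ : ℂ} (hτ : 0 < τ.im) :
    eisensteinTwo (τ + 1) = eisensteinTwo τ := by
  have h := hasSum_eisensteinTwo (τ := τ + 1) (by simpa using hτ)
  rw [mul_add, mul_one, Complex.exp_add, Complex.exp_two_pi_mul_I, mul_one] at h
  exact h.unique (hasSum_eisensteinTwo hτ)

lemma im_neg_one_div_pos {τ : ℂ} (hτ : 0 < τ.im) : 0 < (-1 / τ).im := by
  have := UpperHalfPlane.im_inv_neg_coe_pos ⟨τ, hτ⟩
  convert this using 2
  simp [neg_div, inv_neg]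

lemma eisensteinTwo_neg_one_div {τ : ℂ} (hτ : 0 < τ.im) :
    eisensteinTwo (-1 / τ) = τ ^ 2 * eisensteinTwo τ + 6 * τ / (π * Complex.I) := by
  have hτ0 : τ ≠ 0 := fun h => by simp [h] at hτ
  have h := congrFun (EisensteinSeries.E2_slash_action ModularGroup.S) ⟨τ, hτ⟩
  rw [ModularForm.SL_slash_apply, UpperHalfPlane.modular_S_smul, Pi.sub_apply, Pi.smul_apply,
    EisensteinSeries.D2_S, riemannZeta_two, ModularGroup.denom_S] at h
  rw [eisensteinTwo, eisensteinTwo, UpperHalfPlane.ofComplex_apply_of_im_pos hτ,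
    UpperHalfPlane.ofComplex_apply_of_im_pos (im_neg_one_div_pos hτ)]
  have e : (⟨-1 / τ, im_neg_one_div_pos hτ⟩ : UpperHalfPlane) =
      UpperHalfPlane.mk (-(⟨τ, hτ⟩ : UpperHalfPlane) : ℂ)⁻¹
        (UpperHalfPlane.im_inv_neg_coe_pos ⟨τ, hτ⟩) := by
    ext; simp [neg_div, inv_neg]
  rw [e]
  simp only [smul_eq_mul, zpow_neg, zpow_ofNat] at h
  have hpi : (π : ℂ) ≠ 0 := by exact_mod_cast Real.pi_ne_zero
  have hE := (mul_inv_eq_iff_eq_mul₀ (pow_ne_zero 2 hτ0)).mp h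
  rw [hE]
  field_simp
  linear_combination (-6 : ℂ) * Complex.I_sq

lemma differentiableOn_eisensteinTwo :
    DifferentiableOn ℂ eisensteinTwo UpperHalfPlane.upperHalfPlaneSet :=
  UpperHalfPlane.mdifferentiable_iff.mp E2_mdifferentiable

lemma norm_eisensteinTwo_sub_one_le :
    ∃ K : ℝ, ∀ τ : ℂ, 1 / 2 ≤ τ.im → ‖eisensteinTwo τ - 1‖ ≤ K * Real.exp (-2 * π * τ.im) := by
  have hs : Summable fun m : ℕ =>
      24 * (ArithmeticFunction.sigma 1 (m + 1) : ℝ) * Real.exp (-π) ^ m := by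
    have h := hasSum_eisensteinTwo (τ := Complex.I / 2) (by simp)
    have h1 := ((summable_nat_add_iff 1).mpr h.summable.norm).mul_right (Real.exp (-π))⁻¹
    refine h1.congr fun m => ?_
    simp only [Nat.add_eq_zero_iff, one_ne_zero, and_false, if_false, norm_mul, norm_pow,
      Complex.norm_exp, norm_neg, Complex.norm_natCast, Complex.norm_ofNat, pow_succ]
    have : (2 * π * Complex.I * (Complex.I / 2)).re = -π := by
      rw [show 2 * π * Complex.I * (Complex.I / 2) = ((-π : ℝ) : ℂ) by
        push_cast; linear_combination (π : ℂ) * Complex.I_sq, Complex.ofReal_re]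
    rw [this]
    field_simp
  refine ⟨∑' m : ℕ, 24 * (ArithmeticFunction.sigma 1 (m + 1) : ℝ) * Real.exp (-π) ^ m,
    fun τ hτ => ?_⟩
  have h := (hasSum_nat_add_iff' 1).mpr (hasSum_eisensteinTwo (τ := τ) (by linarith))
  simp only [Finset.range_one, Finset.sum_singleton, if_true, pow_zero, mul_one] at h
  rw [← h.tsum_eq, ← tsum_mul_right]
  refine tsum_of_norm_bounded (hs.mul_right _).hasSum fun m => ?_
  have hq : ‖Complex.exp (2 * π * Complex.I * τ)‖ = Real.exp (-2 * π * τ.im) := by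
    simp [Complex.norm_exp]
  have hle : Real.exp (-2 * π * τ.im) ≤ Real.exp (-π) := by
    apply Real.exp_le_exp.mpr; nlinarith [Real.pi_pos]
  simp only [Nat.add_eq_zero_iff, one_ne_zero, and_false, if_false, norm_mul, norm_pow,
      norm_neg, Complex.norm_natCast, Complex.norm_ofNat, hq, pow_succ, ← mul_assoc]
  gcongr

open Asymptotics Filter UpperHalfPlane ModularForm in
/-- A level one form of weight `12` that decays faster than the discriminant vanishes. -/
lemma eq_zero_of_weight_twelve_of_isLittleO {f : ℂ → ℂ}
    (hd : DifferentiableOn ℂ f upperHalfPlaneSet)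
    (hT : ∀ τ : ℂ, 0 < τ.im → f (τ + 1) = f τ)
    (hS : ∀ τ : ℂ, 0 < τ.im → f (-1 / τ) = τ ^ 12 * f τ)
    (hO : (fun z : ℍ => f z) =o[atImInfty] fun z : ℍ => Real.exp (-2 * π * z.im))
    {τ : ℂ} (hτ : 0 < τ.im) : f τ = 0 := by
  have hS' : (fun z : ℍ => f z) ∣[(12 : ℤ)] ModularGroup.S = fun z : ℍ => f z := by
    ext z
    rw [ModularForm.SL_slash_apply, modular_S_smul, ModularGroup.denom_S]
    have := hS z z.2
    rw [neg_div, one_div, ← inv_neg] at this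
    simp only [zpow_neg, zpow_ofNat, this]
    field_simp [z.ne_zero]
  have hT' : (fun z : ℍ => f z) ∣[(12 : ℤ)] ModularGroup.T = fun z : ℍ => f z := by
    ext z
    have hdenom : denom (ModularGroup.T : Matrix.SpecialLinearGroup (Fin 2) ℤ) z = 1 := by
      rw [ModularGroup.denom_apply]
      simp [ModularGroup.T]
    rw [ModularForm.SL_slash_apply, modular_T_smul, hdenom]
    simp [coe_vadd, add_comm, hT z z.2]
  have hslash := SlashInvariantForm.slash_action_generators_SL2Z hS' hT'
  have hΔ : (fun z : ℍ => f z) =o[atImInfty] ModularForm.discriminant :=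
    hO.trans_isBigO ModularForm.exp_isBigO_discriminant
  have hzero : IsZeroAtImInfty (fun z : ℍ => f z) :=
    hΔ.isBigO.trans_tendsto ModularForm.discriminant_isZeroAtImInfty
  let F : CuspForm (Matrix.SpecialLinearGroup.mapGL (n := Fin 2) (R := ℤ) ℝ).range 12 :=
    { toFun := fun z => f z
      slash_action_eq' := by
        rintro _ ⟨γ, rfl⟩
        exact hslash γ
      holo' := mdifferentiable_iff.mpr <| hd.congr fun z hz => by
        simp [ofComplex_apply_of_im_pos hz]
      zero_at_cusps' := by
        intro c hc
        rw [Subgroup.IsArithmetic.isCusp_iff_isCusp_SL2Z] at hc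
        rw [OnePoint.isZeroAt_iff_forall_SL2Z hc]
        intro γ _
        rw [hslash]
        exact hzero }
  obtain ⟨c, hc⟩ := CuspForm.exists_smul_discriminant_of_weight_eq_twelve F
  have hf (z : ℍ) : f z = c * ModularForm.discriminant z := (DFunLike.congr_fun hc z).symm
  by_cases hc0 : c = 0
  · simpa [hc0] using hf ⟨τ, hτ⟩
  · exfalso
    have h1 : ModularForm.discriminant =o[atImInfty] ModularForm.discriminant := by
      have := hΔ.const_mul_left c⁻¹
      refine this.congr_left fun z => ?_
      rw [hf, inv_mul_cancel_left₀ hc0]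
    have h2 := isLittleO_irrefl
      (f'' := ModularForm.discriminant) (l := atImInfty)
      (Eventually.frequently (.of_forall ModularForm.discriminant_ne_zero))
    exact h2 h1

lemma jacobiTheta₂_add_one (z τ : ℂ) : jacobiTheta₂ z (τ + 1) = jacobiTheta₂ (z + 1 / 2) τ := by
  refine tsum_congr fun n => ?_
  obtain ⟨k, hk⟩ := (Int.even_mul_pred_self n)
  have hk' : (n : ℂ) * (n - 1) = k + k := by exact_mod_cast hk
  rw [jacobiTheta₂_term, jacobiTheta₂_term, Complex.exp_eq_exp_iff_exists_int]
  exact ⟨k, by linear_combination (π * Complex.I) * hk'⟩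

lemma jacobiTheta_add_one (τ : ℂ) : jacobiTheta (τ + 1) = jacobiTheta₂ (1 / 2) τ := by
  rw [jacobiTheta_eq_jacobiTheta₂, jacobiTheta₂_add_one, zero_add]

lemma jacobiTheta₂_pow_four_neg_one_div (z : ℂ) {τ : ℂ} (hτ : 0 < τ.im) :
    Complex.exp (-π * Complex.I * z ^ 2 / τ) ^ 4 * jacobiTheta₂ (z / τ) (-1 / τ) ^ 4 =
      -τ ^ 2 * jacobiTheta₂ z τ ^ 4 := by
  have hτ0 : τ ≠ 0 := fun h => by simp [h] at hτ
  have h4 : ((-Complex.I * τ) ^ (1 / 2 : ℂ)) ^ 4 = -τ ^ 2 := by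
    rw [← Complex.cpow_nat_mul, show ((4 : ℕ) : ℂ) * (1 / 2) = ((2 : ℕ) : ℂ) by norm_num,
      Complex.cpow_natCast]
    linear_combination τ ^ 2 * Complex.I_sq
  rw [jacobiTheta₂_functional_equation z τ, mul_pow, mul_pow, div_pow, h4]
  field_simp

/-- The fourth power of the theta constant `θ₂`. -/
def thetaTwoPowFour (τ : ℂ) : ℂ := Complex.exp (π * Complex.I * τ) * jacobiTheta₂ (τ / 2) τ ^ 4

lemma thetaTwoPowFour_add_one (τ : ℂ) : thetaTwoPowFour (τ + 1) = -thetaTwoPowFour τ := by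
  rw [thetaTwoPowFour, thetaTwoPowFour, jacobiTheta₂_add_one,
    show (τ + 1) / 2 + 1 / 2 = τ / 2 + 1 by ring, jacobiTheta₂_add_left, mul_add, mul_one,
    Complex.exp_add, Complex.exp_pi_mul_I]
  ring

lemma thetaTwoPowFour_neg_one_div {τ : ℂ} (hτ : 0 < τ.im) :
    thetaTwoPowFour (-1 / τ) = -τ ^ 2 * jacobiTheta (τ + 1) ^ 4 := by
  rw [jacobiTheta_add_one, ← jacobiTheta₂_pow_four_neg_one_div _ hτ, thetaTwoPowFour,
    ← jacobiTheta₂_neg_left, ← Complex.exp_nat_mul]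
  congr 2
  · push_cast; ring
  · congr 1; ring

lemma jacobiTheta_pow_four_neg_one_div {τ : ℂ} (hτ : 0 < τ.im) :
    jacobiTheta (-1 / τ) ^ 4 = -τ ^ 2 * jacobiTheta τ ^ 4 := by
  simpa [jacobiTheta_eq_jacobiTheta₂] using jacobiTheta₂_pow_four_neg_one_div 0 hτ

lemma jacobiTheta_neg_one_div_add_one_pow_four {τ : ℂ} (hτ : 0 < τ.im) :
    jacobiTheta (-1 / τ + 1) ^ 4 = -τ ^ 2 * thetaTwoPowFour τ := by
  have hτ0 : τ ≠ 0 := fun h => by simp [h] at hτ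
  have h := thetaTwoPowFour_neg_one_div (im_neg_one_div_pos hτ)
  rw [show -1 / (-1 / τ) = τ by field_simp] at h
  rw [h]
  field_simp

lemma eisensteinTwo_two_mul_neg_one_div {τ : ℂ} (hτ : 0 < τ.im) :
    4 * eisensteinTwo (2 * (-1 / τ)) =
      τ ^ 2 * eisensteinTwo (τ / 2) + 12 * τ / (π * Complex.I) := by
  have h := eisensteinTwo_neg_one_div (τ := τ / 2) (by simpa using hτ)
  rw [show 2 * (-1 / τ) = -1 / (τ / 2) by field_simp, h]
  ring

lemma eisensteinTwo_neg_one_div_div_two {τ : ℂ} (hτ : 0 < τ.im) :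
    eisensteinTwo (-1 / τ / 2) =
      4 * τ ^ 2 * eisensteinTwo (2 * τ) + 12 * τ / (π * Complex.I) := by
  have h := eisensteinTwo_neg_one_div (τ := 2 * τ) (by simpa using hτ)
  rw [show -1 / τ / 2 = -1 / (2 * τ) by field_simp, h]
  ring

lemma eisensteinTwo_neg_one_div_add_one_div_two {τ : ℂ} (hτ : 0 < τ.im) :
    eisensteinTwo ((-1 / τ + 1) / 2) =
      τ ^ 2 * eisensteinTwo ((τ + 1) / 2) + 12 * τ / (π * Complex.I) := by
  have hτ0 : τ ≠ 0 := fun h => by simp [h] at hτ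
  have hτ1 : τ - 1 ≠ 0 := fun h => by simp [sub_eq_zero.mp h] at hτ
  have hv : 0 < ((τ - 1) / 2).im := by simpa using hτ
  have hx : 0 < (-1 / ((τ - 1) / 2) - 1 - 1).im := by simpa using! im_neg_one_div_pos hv
  have h1 := eisensteinTwo_add_one hv
  have h2 := eisensteinTwo_neg_one_div hv
  have h3 := eisensteinTwo_add_one hx
  have h4 := eisensteinTwo_add_one (τ := -1 / ((τ - 1) / 2) - 1) (by simpa using! hx)
  have h5 := eisensteinTwo_neg_one_div hx
  rw [sub_add_cancel] at h3 h4
  rw [← h3, ← h4, h2, ← h1, show -1 / (-1 / ((τ - 1) / 2) - 1 - 1) = (-1 / τ + 1) / 2 by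
      rw [show -1 / ((τ - 1) / 2) - 1 - 1 = -2 * τ / (τ - 1) by field_simp; ring]
      field_simp; ring,
    show (τ - 1) / 2 + 1 = (τ + 1) / 2 by ring] at h5
  have hpi : (π : ℂ) ≠ 0 := by exact_mod_cast Real.pi_ne_zero
  rw [h5]
  field_simp
  ring

/-- `θ₃⁴` minus the corresponding Eisenstein series. -/
def thetaThreeDefect (τ : ℂ) : ℂ :=
  jacobiTheta τ ^ 4 - (4 * eisensteinTwo (2 * τ) - eisensteinTwo (τ / 2)) / 3

/-- `θ₄⁴` minus the corresponding Eisenstein series. -/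
def thetaFourDefect (τ : ℂ) : ℂ :=
  jacobiTheta (τ + 1) ^ 4 - (4 * eisensteinTwo (2 * τ) - eisensteinTwo ((τ + 1) / 2)) / 3

/-- `θ₂⁴` minus the corresponding Eisenstein series. -/
def thetaTwoDefect (τ : ℂ) : ℂ :=
  thetaTwoPowFour τ - (eisensteinTwo ((τ + 1) / 2) - eisensteinTwo (τ / 2)) / 3

lemma eisensteinTwo_two_mul_add_one {τ : ℂ} (hτ : 0 < τ.im) :
    eisensteinTwo (2 * (τ + 1)) = eisensteinTwo (2 * τ) := by
  rw [show 2 * (τ + 1) = 2 * τ + 1 + 1 by ring, eisensteinTwo_add_one (by simpa using hτ),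
    eisensteinTwo_add_one (by simpa using hτ)]

lemma eisensteinTwo_add_one_add_one_div_two {τ : ℂ} (hτ : 0 < τ.im) :
    eisensteinTwo ((τ + 1 + 1) / 2) = eisensteinTwo (τ / 2) := by
  rw [show (τ + 1 + 1) / 2 = τ / 2 + 1 by ring, eisensteinTwo_add_one (by simpa using hτ)]

lemma thetaThreeDefect_add_one {τ : ℂ} (hτ : 0 < τ.im) :
    thetaThreeDefect (τ + 1) = thetaFourDefect τ := by
  rw [thetaThreeDefect, thetaFourDefect, eisensteinTwo_two_mul_add_one hτ]

lemma thetaFourDefect_add_one {τ : ℂ} (hτ : 0 < τ.im) :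
    thetaFourDefect (τ + 1) = thetaThreeDefect τ := by
  rw [thetaThreeDefect, thetaFourDefect, eisensteinTwo_two_mul_add_one hτ,
    eisensteinTwo_add_one_add_one_div_two hτ, show τ + 1 + 1 = 2 + τ by ring, jacobiTheta_two_add]

lemma thetaTwoDefect_add_one {τ : ℂ} (hτ : 0 < τ.im) :
    thetaTwoDefect (τ + 1) = -thetaTwoDefect τ := by
  rw [thetaTwoDefect, thetaTwoDefect, eisensteinTwo_add_one_add_one_div_two hτ,
    thetaTwoPowFour_add_one]
  ring

lemma thetaThreeDefect_neg_one_div {τ : ℂ} (hτ : 0 < τ.im) :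
    thetaThreeDefect (-1 / τ) = -τ ^ 2 * thetaThreeDefect τ := by
  rw [thetaThreeDefect, thetaThreeDefect, eisensteinTwo_two_mul_neg_one_div hτ,
    eisensteinTwo_neg_one_div_div_two hτ, jacobiTheta_pow_four_neg_one_div hτ]
  ring

lemma thetaFourDefect_neg_one_div {τ : ℂ} (hτ : 0 < τ.im) :
    thetaFourDefect (-1 / τ) = -τ ^ 2 * thetaTwoDefect τ := by
  rw [thetaFourDefect, thetaTwoDefect, eisensteinTwo_two_mul_neg_one_div hτ,
    eisensteinTwo_neg_one_div_add_one_div_two hτ, jacobiTheta_neg_one_div_add_one_pow_four hτ]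
  ring

lemma thetaTwoDefect_neg_one_div {τ : ℂ} (hτ : 0 < τ.im) :
    thetaTwoDefect (-1 / τ) = -τ ^ 2 * thetaFourDefect τ := by
  rw [thetaFourDefect, thetaTwoDefect, eisensteinTwo_neg_one_div_div_two hτ,
    eisensteinTwo_neg_one_div_add_one_div_two hτ, thetaTwoPowFour_neg_one_div hτ]
  ring

section Decay

open Asymptotics Filter Topology

lemma tendsto_exp_neg_pi_mul_im :
    Tendsto (fun τ : ℂ => Real.exp (-π * τ.im)) (comap Complex.im atTop) (𝓝 0) := by
  refine Real.tendsto_exp_atBot.comp ?_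
  exact (tendsto_comap (f := Complex.im)).const_mul_atTop_of_neg (neg_lt_zero.mpr Real.pi_pos)

lemma isBigO_eisensteinTwo_comp_sub_one {g : ℂ → ℂ}
    (hg : ∀ᶠ τ in comap Complex.im atTop, τ.im / 2 ≤ (g τ).im) :
    (fun τ => eisensteinTwo (g τ) - 1) =O[comap Complex.im atTop]
      fun τ => Real.exp (-π * τ.im) := by
  obtain ⟨K, hK⟩ := norm_eisensteinTwo_sub_one_le
  have hK0 : 0 ≤ K := by
    have := (norm_nonneg _).trans (hK Complex.I (by norm_num))
    exact nonneg_of_mul_nonneg_left this (Real.exp_pos _)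
  refine .of_bound K ?_
  filter_upwards [preimage_mem_comap (Ici_mem_atTop (1 : ℝ)), hg] with τ hτ hgτ
  have h1 : 1 ≤ τ.im := hτ
  rw [Real.norm_of_nonneg (Real.exp_pos _).le]
  refine (hK _ (by linarith [hgτ])).trans ?_
  gcongr ?_ * Real.exp ?_
  nlinarith [hgτ, Real.pi_pos]

lemma isBigO_eisensteinTwo_two_mul_sub_one :
    (fun τ => eisensteinTwo (2 * τ) - 1) =O[comap Complex.im atTop]
      fun τ => Real.exp (-π * τ.im) := by
  refine isBigO_eisensteinTwo_comp_sub_one ?_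
  filter_upwards [preimage_mem_comap (Ici_mem_atTop (0 : ℝ))] with τ hτ
  have h0 : 0 ≤ τ.im := hτ
  simp only [Complex.mul_im, Complex.re_ofNat, Complex.im_ofNat]
  linarith

lemma isBigO_jacobiTheta_pow_four_sub_one :
    (fun τ => jacobiTheta τ ^ 4 - 1) =O[comap Complex.im atTop]
      fun τ => Real.exp (-π * τ.im) := by
  have h := isBigO_at_im_infty_jacobiTheta_sub_one
  have h0 : Tendsto jacobiTheta (comap Complex.im atTop) (𝓝 1) := by
    simpa using (h.trans_tendsto tendsto_exp_neg_pi_mul_im).add_const 1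
  have h1 : (fun τ => jacobiTheta τ ^ 3 + jacobiTheta τ ^ 2 + jacobiTheta τ + 1)
      =O[comap Complex.im atTop] fun _ => (1 : ℝ) :=
    ((((h0.pow 3).add (h0.pow 2)).add h0).add_const 1).isBigO_one ℝ
  refine (h.mul h1).congr (fun τ => ?_) (fun τ => mul_one _)
  ring

lemma isBigO_thetaTwoPowFour :
    thetaTwoPowFour =O[comap Complex.im atTop] fun τ => Real.exp (-π * τ.im) := by
  have hb : (fun τ => jacobiTheta₂ (τ / 2) τ) =O[comap Complex.im atTop] fun _ => (1 : ℝ) := by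
    refine .of_bound (∑' n : ℤ, ‖jacobiTheta₂_term n (Complex.I / 2) Complex.I‖) ?_
    filter_upwards [preimage_mem_comap (Ici_mem_atTop (1 : ℝ))] with τ hτ
    have h1 : 1 ≤ τ.im := hτ
    rw [norm_one, mul_one]
    refine tsum_of_norm_bounded
      ((summable_jacobiTheta₂_term_iff (Complex.I / 2) Complex.I).mpr (by simp)).norm.hasSum
      fun n => ?_
    rw [norm_jacobiTheta₂_term, norm_jacobiTheta₂_term]
    have e1 : (τ / 2).im = τ.im / 2 := by simp
    have e2 : (Complex.I / 2).im = 1 / 2 := by simp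
    rw [e1, e2, Complex.I_im, Real.exp_le_exp]
    have hn : (0 : ℝ) ≤ (n : ℝ) ^ 2 + n := by
      have : (0 : ℤ) ≤ n ^ 2 + n := by nlinarith [Int.le_self_sq (-n)]
      exact_mod_cast this
    nlinarith [mul_nonneg (mul_nonneg Real.pi_pos.le hn) (sub_nonneg.mpr h1)]
  have he : (fun τ : ℂ => Complex.exp (π * Complex.I * τ)) =O[comap Complex.im atTop]
      fun τ => Real.exp (-π * τ.im) :=
    .of_norm_le fun τ => by simp [Complex.norm_exp]
  simpa using! he.mul (hb.pow 4)

lemma isBigO_thetaThreeDefect :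
    thetaThreeDefect =O[comap Complex.im atTop] fun τ => Real.exp (-π * τ.im) := by
  have h2 := isBigO_eisensteinTwo_two_mul_sub_one
  have h1 := isBigO_eisensteinTwo_comp_sub_one (g := fun τ => τ / 2) (.of_forall fun τ => by simp)
  refine (isBigO_jacobiTheta_pow_four_sub_one.sub
    (((h2.const_mul_left 4).sub h1).const_mul_left (1 / 3))).congr_left fun τ => ?_
  rw [thetaThreeDefect]
  ring

lemma isBigO_thetaFourDefect :
    thetaFourDefect =O[comap Complex.im atTop] fun τ => Real.exp (-π * τ.im) := by
  have h2 := isBigO_eisensteinTwo_two_mul_sub_one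
  have h1 := isBigO_eisensteinTwo_comp_sub_one (g := fun τ => (τ + 1) / 2)
    (.of_forall fun τ => by simp)
  have hshift : Tendsto (fun τ : ℂ => τ + 1) (comap Complex.im atTop) (comap Complex.im atTop) :=
    tendsto_comap_iff.mpr (tendsto_comap.congr fun τ => by simp)
  have h0 : (fun τ => jacobiTheta (τ + 1) ^ 4 - 1) =O[comap Complex.im atTop]
      fun τ => Real.exp (-π * τ.im) := by
    refine (isBigO_jacobiTheta_pow_four_sub_one.comp_tendsto hshift).congr_right fun τ => ?_
    simp
  refine (h0.sub (((h2.const_mul_left 4).sub h1).const_mul_left (1 / 3))).congr_left fun τ => ?_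
  rw [thetaFourDefect]
  ring

lemma isBigO_thetaTwoDefect :
    thetaTwoDefect =O[comap Complex.im atTop] fun τ => Real.exp (-π * τ.im) := by
  have h2 := isBigO_eisensteinTwo_comp_sub_one (g := fun τ => (τ + 1) / 2)
    (.of_forall fun τ => by simp)
  have h1 := isBigO_eisensteinTwo_comp_sub_one (g := fun τ => τ / 2) (.of_forall fun τ => by simp)
  refine (isBigO_thetaTwoPowFour.sub
    ((h2.sub h1).const_mul_left (1 / 3))).congr_left fun τ => ?_
  rw [thetaTwoDefect]
  ring

end Decay

section Vanishing

open Asymptotics Filter Topology UpperHalfPlane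

lemma differentiableOn_eisensteinTwo_comp {g : ℂ → ℂ} (hg : Differentiable ℂ g)
    (hpos : ∀ τ : ℂ, 0 < τ.im → 0 < (g τ).im) :
    DifferentiableOn ℂ (fun τ => eisensteinTwo (g τ)) upperHalfPlaneSet :=
  differentiableOn_eisensteinTwo.comp hg.differentiableOn hpos

lemma differentiableOn_eisensteinTwo_two_mul :
    DifferentiableOn ℂ (fun τ => eisensteinTwo (2 * τ)) upperHalfPlaneSet :=
  differentiableOn_eisensteinTwo_comp (by fun_prop) fun τ hτ => by simpa using hτ

lemma differentiableOn_eisensteinTwo_div_two :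
    DifferentiableOn ℂ (fun τ => eisensteinTwo (τ / 2)) upperHalfPlaneSet :=
  differentiableOn_eisensteinTwo_comp (by fun_prop) fun τ hτ => by simpa using hτ

lemma differentiableOn_eisensteinTwo_add_one_div_two :
    DifferentiableOn ℂ (fun τ => eisensteinTwo ((τ + 1) / 2)) upperHalfPlaneSet :=
  differentiableOn_eisensteinTwo_comp (by fun_prop) fun τ hτ => by simpa using hτ

lemma differentiableOn_thetaThreeDefect : DifferentiableOn ℂ thetaThreeDefect upperHalfPlaneSet := by
  have h : DifferentiableOn ℂ jacobiTheta upperHalfPlaneSet := fun τ hτ =>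
    (differentiableAt_jacobiTheta hτ).differentiableWithinAt
  exact (h.pow 4).sub (((differentiableOn_eisensteinTwo_two_mul.const_mul 4).sub
    differentiableOn_eisensteinTwo_div_two).div_const 3)

lemma differentiableOn_thetaFourDefect : DifferentiableOn ℂ thetaFourDefect upperHalfPlaneSet := by
  have h : DifferentiableOn ℂ (fun τ => jacobiTheta (τ + 1)) upperHalfPlaneSet := by
    simp_rw [jacobiTheta_add_one]
    exact fun τ hτ => (differentiableAt_jacobiTheta₂_snd _ hτ).differentiableWithinAt
  exact (h.pow 4).sub (((differentiableOn_eisensteinTwo_two_mul.const_mul 4).sub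
    differentiableOn_eisensteinTwo_add_one_div_two).div_const 3)

lemma differentiableOn_thetaTwoDefect : DifferentiableOn ℂ thetaTwoDefect upperHalfPlaneSet := by
  have h : DifferentiableOn ℂ (fun τ => jacobiTheta₂ (τ / 2) τ) upperHalfPlaneSet := fun τ hτ =>
    DifferentiableAt.differentiableWithinAt <|
      (hasFDerivAt_jacobiTheta₂ (τ / 2) hτ).differentiableAt.comp τ
        (f := fun τ : ℂ => (τ / 2, τ)) (by fun_prop)
  have he : DifferentiableOn ℂ (fun τ => Complex.exp (π * Complex.I * τ)) upperHalfPlaneSet := by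
    fun_prop
  exact (he.mul (h.pow 4)).sub ((differentiableOn_eisensteinTwo_add_one_div_two.sub
    differentiableOn_eisensteinTwo_div_two).div_const 3)

lemma sq_thetaDefect_prod_eq_zero {τ : ℂ} (hτ : 0 < τ.im) :
    (thetaTwoDefect τ * thetaThreeDefect τ * thetaFourDefect τ) ^ 2 = 0 := by
  refine eq_zero_of_weight_twelve_of_isLittleO
    (f := fun τ => (thetaTwoDefect τ * thetaThreeDefect τ * thetaFourDefect τ) ^ 2)
    (((differentiableOn_thetaTwoDefect.mul differentiableOn_thetaThreeDefect).mul
      differentiableOn_thetaFourDefect).pow 2) (fun τ hτ => ?_) (fun τ hτ => ?_) ?_ hτ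
  · simp only [thetaTwoDefect_add_one hτ, thetaThreeDefect_add_one hτ, thetaFourDefect_add_one hτ]
    ring
  · simp only [thetaTwoDefect_neg_one_div hτ, thetaThreeDefect_neg_one_div hτ,
      thetaFourDefect_neg_one_div hτ]
    ring
  · have h0 : Tendsto (fun z : ℍ => (z : ℂ)) atImInfty (comap Complex.im atTop) :=
      tendsto_comap_iff.mpr tendsto_comap
    refine IsBigO.trans_isLittleO ((((isBigO_thetaTwoDefect.mul isBigO_thetaThreeDefect).mul
      isBigO_thetaFourDefect).pow 2).comp_tendsto h0) ?_
    have h1 := (tendsto_exp_neg_pi_mul_im.comp h0).pow 4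
    rw [zero_pow (by norm_num)] at h1
    have h2 := ((isLittleO_one_iff ℝ).mpr h1).mul_isBigO
      (isBigO_refl (fun z : ℍ => Real.exp (-2 * π * z.im)) atImInfty)
    refine h2.congr (fun z => ?_) (fun z => one_mul _)
    simp only [Function.comp_apply, coe_im, ← Real.exp_nat_mul, ← Real.exp_add]
    congr 1
    push_cast
    ring

lemma thetaFourDefect_eq_zero {τ : ℂ} (hτ : 0 < τ.im) : thetaFourDefect τ = 0 := by
  have hconn : IsPreconnected upperHalfPlaneSet :=
    (convex_halfSpace_im_gt 0).isPreconnected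
  have a2 := differentiableOn_thetaTwoDefect.analyticOnNhd isOpen_upperHalfPlaneSet
  have a3 := differentiableOn_thetaThreeDefect.analyticOnNhd isOpen_upperHalfPlaneSet
  have a4 := differentiableOn_thetaFourDefect.analyticOnNhd isOpen_upperHalfPlaneSet
  have hprod : ∀ z ∈ upperHalfPlaneSet,
      thetaTwoDefect z * thetaThreeDefect z * thetaFourDefect z = 0 := fun z hz =>
    pow_eq_zero_iff two_ne_zero |>.mp (sq_thetaDefect_prod_eq_zero hz)
  rcases (a2.mul a3).eq_zero_or_eq_zero_of_mul_eq_zero a4 hprod hconn with h | h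
  · rcases a2.eq_zero_or_eq_zero_of_mul_eq_zero a3 h hconn with h | h
    · have h' := thetaTwoDefect_neg_one_div hτ
      rw [h _ (im_neg_one_div_pos hτ)] at h'
      have hτ0 : τ ≠ 0 := fun h => by simp [h] at hτ
      simpa [hτ0] using h'.symm
    · rw [← thetaThreeDefect_add_one hτ]
      exact h _ (by simpa [upperHalfPlaneSet] using hτ)
  · exact h τ hτ

end Vanishing

lemma sigma_one_two_pow_mul (l : ℕ) {m : ℕ} (hm : Odd m) :
    (ArithmeticFunction.sigma 1 (2 ^ l * m) : ℤ) =
      (2 ^ (l + 1) - 1) * ArithmeticFunction.sigma 1 m := by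
  rw [ArithmeticFunction.isMultiplicative_sigma.map_mul_of_coprime
      (Nat.Coprime.pow_left l (Nat.coprime_two_left.mpr hm)),
    ArithmeticFunction.sigma_one_apply_prime_pow Nat.prime_two]
  push_cast
  rw [← geom_sum_mul (2 : ℤ) (l + 1)]
  ring

lemma paperC_two_pow_succ_mul (l : ℕ) {m : ℕ} (hm : Odd m) :
    paperC (2 ^ (l + 1) * m) = -3 * (ArithmeticFunction.sigma 1 m : ℤ) := by
  have hodd : ¬ Odd (2 ^ (l + 1) * m) := by
    rw [Nat.not_odd_iff_even, pow_succ']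
    exact ((even_two_mul _).mul_right m)
  have hm0 : m ≠ 0 := by rintro rfl; simp at hm
  rw [paperC, if_neg hodd, Nat.factorization_mul (by positivity) hm0, Finsupp.add_apply,
    Nat.prime_two.factorization_pow, Finsupp.single_eq_same,
    Nat.factorization_eq_zero_of_not_dvd (n := m) (p := 2)
      (by rwa [← even_iff_two_dvd, Nat.not_even_iff_odd]),
    add_zero, Nat.mul_div_cancel_left _ (by positivity)]

/-- The coefficients of the Eisenstein series `(4 E₂(2τ) - E₂((τ + 1) / 2)) / 3`. -/
lemma four_mul_coeff_sub_eq_paperC (k : ℕ) (a : ℕ → ℤ) (ha0 : a 0 = 1)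
    (ha : ∀ m ≠ 0, a m = -24 * (ArithmeticFunction.sigma 1 m : ℤ)) :
    4 * (if 4 ∣ k then a (k / 4) else 0) - (-1) ^ k * a k =
      3 * ((if k = 0 then 1 else 0) - 8 * paperC k) := by
  rcases eq_or_ne k 0 with rfl | hk
  · simp [ha0, paperC]
  obtain ⟨l, m, hm, rfl⟩ := Nat.exists_eq_two_pow_mul_odd hk
  have hm0 : m ≠ 0 := by rintro rfl; simp at hm
  rw [ha _ hk, if_neg hk]
  rcases l with _ | _ | l
  · have h4 : ¬ 4 ∣ 2 ^ 0 * m := by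
      rw [pow_zero, one_mul]; intro h; have := hm.not_two_dvd_nat; omega
    rw [if_neg h4]
    simp only [pow_zero, one_mul, paperC, if_pos hm, hm.neg_one_pow]
    ring
  · have h4 : ¬ 4 ∣ 2 ^ (0 + 1) * m := by
      intro h; have := hm.not_two_dvd_nat; omega
    rw [if_neg h4, paperC_two_pow_succ_mul 0 hm, sigma_one_two_pow_mul _ hm,
      Even.neg_one_pow (by simp)]
    ring
  · have h4 : 2 ^ (l + 1 + 1) * m = 4 * (2 ^ l * m) := by ring
    rw [if_pos (h4 ▸ Nat.dvd_mul_right 4 _), paperC_two_pow_succ_mul _ hm,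
      sigma_one_two_pow_mul _ hm, h4, Nat.mul_div_cancel_left _ (by norm_num),
      ha _ (by positivity), sigma_one_two_pow_mul _ hm,
      Even.neg_one_pow (by simp [parity_simps])]
    ring

open UpperHalfPlane in
lemma hasSum_paperC_mul_pow {y : ℝ} (hy : 0 < y) :
    HasSum (fun k : ℕ => ((if k = 0 then 1 else 0) - 8 * paperC k : ℂ) *
      (Real.exp (-(π * y)) : ℂ) ^ k) (jacobiTheta (Complex.I * y + 1) ^ 4) := by
  set q : ℂ := (Real.exp (-(π * y)) : ℂ) with hq
  have hτ : 0 < (Complex.I * y).im := by simpa using hy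
  have hθ := sub_eq_zero.mp (thetaFourDefect_eq_zero hτ)
  rw [hθ]
  have h1 := hasSum_eisensteinTwo (τ := 2 * (Complex.I * y)) (by simpa using hy)
  have h2 := hasSum_eisensteinTwo (τ := (Complex.I * y + 1) / 2) (by simpa using hy)
  have e1 : Complex.exp (2 * π * Complex.I * (2 * (Complex.I * y))) = q ^ 4 := by
    rw [hq, Complex.ofReal_exp, ← Complex.exp_nat_mul]
    congr 1
    push_cast
    linear_combination (4 * π * y : ℂ) * Complex.I_sq
  have e2 : Complex.exp (2 * π * Complex.I * ((Complex.I * y + 1) / 2)) = -q := by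
    rw [hq, Complex.ofReal_exp, ← mul_neg_one, ← Complex.exp_pi_mul_I, ← Complex.exp_add]
    congr 1
    push_cast
    linear_combination (π * y : ℂ) * Complex.I_sq
  rw [e1] at h1
  rw [e2] at h2
  let a : ℕ → ℤ := fun m => if m = 0 then 1 else -24 * (ArithmeticFunction.sigma 1 m : ℤ)
  have h3 : HasSum (fun k : ℕ => ((if 4 ∣ k then a (k / 4) else 0 : ℤ) : ℂ) * q ^ k)
      (eisensteinTwo (2 * (Complex.I * y))) := by
    rw [← (mul_right_injective₀ (four_ne_zero' ℕ)).hasSum_iff]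
    · refine h1.congr_fun fun m => ?_
      simp [a, pow_mul]
    · intro k hk
      rw [if_neg fun ⟨j, hj⟩ => hk ⟨j, hj.symm⟩]
      simp
  refine (((h3.mul_left 4).sub h2).div_const 3).congr_fun fun k => ?_
  have hc := congrArg (Int.cast : ℤ → ℂ)
    (four_mul_coeff_sub_eq_paperC k a (by simp [a]) fun m hm => by simp [a, hm])
  rw [neg_pow q]
  simp only [a] at hc ⊢
  push_cast at hc ⊢
  linear_combination (-q ^ k / 3) * hc

theorem theta4_pow_four (y : ℝ) (hy : 0 < y) :
    Summable (fun k : ℕ => |(paperC k : ℝ) * Real.exp (-(π * k * y))|) ∧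
    (∑' n : ℤ, (-1 : ℝ) ^ n * Real.exp (-(π * (n : ℝ) ^ 2 * y))) ^ 4 =
      1 - 8 * ∑' k : ℕ, (paperC k : ℝ) * Real.exp (-(π * k * y)) := by
  have hθ : jacobiTheta (Complex.I * y + 1) =
      ((∑' n : ℤ, (-1 : ℝ) ^ n * Real.exp (-(π * (n : ℝ) ^ 2 * y)) : ℝ) : ℂ) := by
    rw [jacobiTheta_add_one, Complex.ofReal_tsum]
    refine tsum_congr fun n => ?_
    push_cast
    rw [jacobiTheta₂_term, Complex.exp_add, ← Complex.exp_pi_mul_I, ← Complex.exp_int_mul]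
    congr 2
    · ring
    · linear_combination (π * n ^ 2 * y : ℂ) * Complex.I_sq
  have h := hasSum_paperC_mul_pow hy
  have h' : HasSum (fun k : ℕ => (((if k = 0 then 1 else 0) - 8 * paperC k : ℝ)) *
      Real.exp (-(π * k * y)))
      ((∑' n : ℤ, (-1 : ℝ) ^ n * Real.exp (-(π * (n : ℝ) ^ 2 * y))) ^ 4) := by
    rw [hθ, ← Complex.ofReal_pow] at h
    rw [← Complex.hasSum_ofReal]
    refine h.congr_fun fun k => ?_
    rw [← Complex.ofReal_pow, ← Real.exp_nat_mul, show -(π * k * y) = k * -(π * y) by ring]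
    split_ifs <;> push_cast <;> ring
  have h0 : HasSum (fun k : ℕ => if k = 0 then (1 : ℝ) else 0) 1 := hasSum_ite_eq 0 1
  have hc : HasSum (fun k : ℕ => (paperC k : ℝ) * Real.exp (-(π * k * y))) _ :=
    ((h0.sub h').div_const 8).congr_fun fun k => by
      rcases eq_or_ne k 0 with rfl | hk
      · simp
      · simp only [hk, if_false]
        ring
  refine ⟨hc.summable.abs, ?_⟩
  rw [hc.tsum_eq]
  ring
end
end
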